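/- Suppose f_i : X_i → Y_i (i = 1, 2) are continuous surjective maps between second countable spaces such that for every open subset U_i ⊆ Y_i, the restriction f_i : f_i^{-1}(U_i) → U_i is a weak homotopy equivalence. Then for every open subset U ⊆ Y₁ × Y₂, the restriction of f₁ × f₂ to (f₁ × f₂)^{-1}(U) → U is a weak homotopy equivalence. -/

import Mathlib

/-!
Statement 16 (Lemma `lem_prod_universal_hmty_equiv`): if `f₁ : X₁ → Y₁` and `f₂ : X₂ → Y₂`
are continuous surjections between second countable spaces such that over every open subset
of the codomain the restriction is a weak homotopy equivalence, then the same holds for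
`f₁ × f₂` over every open subset of `Y₁ × Y₂`.
-/

open scoped Topology

noncomputable section

/-- The map induced on homotopy groups by a pointed continuous map. -/
def piMap {X Y : Type*} [TopologicalSpace X] [TopologicalSpace Y] (n : ℕ)
    (f : C(X, Y)) {x : X} {y : Y} (hf : f x = y) :
    π_ n X x → π_ n Y y :=
  Quotient.map
    (fun p => ⟨f.comp p.1, fun z hz => by
      simp only [ContinuousMap.comp_apply]
      rw [p.2 z hz, hf]⟩)
    (fun p q h => h.map fun H => H.compContinuousMap f)

/-- A continuous map is a weak homotopy equivalence: it is bijective on all homotopy groups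
at all base points and surjective on path components. -/
def IsWeakHomotopyEquiv {X Y : Type*} [TopologicalSpace X] [TopologicalSpace Y]
    (f : C(X, Y)) : Prop :=
  (∀ y : Y, ∃ x : X, Joined (f x) y) ∧
    ∀ (n : ℕ) (x : X), Function.Bijective (piMap n f (x := x) rfl)

/-- The restriction of a continuous map to the preimage of a subset of the codomain. -/
def ContinuousMap.restrictPreimageCM {X Y : Type*} [TopologicalSpace X] [TopologicalSpace Y]
    (f : C(X, Y)) (U : Set Y) : C(↥(f ⁻¹' U), ↥U) :=
  ⟨U.restrictPreimage f, f.continuous.restrictPreimage⟩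

open Set unitInterval ContinuousMap

section HomotopyExtension

variable {K Z : Type*} [TopologicalSpace K] [TopologicalSpace Z]

/-- The pair `(K, A)` has the homotopy extension property, expressed by a retraction of `K × I`
onto `K × {0} ∪ A × I`. -/
def HasHEP (A : Set K) : Prop :=
  ∃ r : C(K × I, K × I), (∀ p, (r p).2 = 0 ∨ (r p).1 ∈ A) ∧ ∀ p, p.2 = 0 ∨ p.1 ∈ A → r p = p

theorem HasHEP.extend {A : Set K} (h : HasHEP A) (hA : IsClosed A) (g : C(K, Z)) (φ : K × I → Z)
    (hφ : ContinuousOn φ (A ×ˢ univ)) (h0 : ∀ z ∈ A, φ (z, 0) = g z) :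
    ∃ H : C(K × I, Z), (∀ z, H (z, 0) = g z) ∧ ∀ z ∈ A, ∀ t, H (z, t) = φ (z, t) := by
  obtain ⟨r, hr, hfix⟩ := h
  let ψ : K × I → Z := fun p => if p.2 = 0 then g p.1 else φ p
  have hψA : ∀ p : K × I, p.1 ∈ A → ψ p = φ p := by
    rintro ⟨z, t⟩ hz
    by_cases ht : t = 0
    · subst ht
      simp [ψ, h0 z hz]
    · simp [ψ, ht]
  have hψ : ContinuousOn ψ ({p | p.2 = 0} ∪ A ×ˢ univ) := by
    refine ContinuousOn.union_of_isClosed ?_ ?_ (isClosed_eq continuous_snd continuous_const)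
      (hA.prod isClosed_univ)
    · refine (g.continuous.comp continuous_fst).continuousOn.congr fun p hp => ?_
      exact if_pos hp
    · exact hφ.congr fun p hp => hψA p hp.1
  refine ⟨⟨ψ ∘ r, hψ.comp_continuous r.continuous fun p => ?_⟩, fun z => ?_, fun z hz t => ?_⟩
  · exact (hr p).imp id fun h => ⟨h, mem_univ _⟩
  · simp [hfix (z, 0) (Or.inl rfl), ψ]
  · simp only [coe_mk, Function.comp_apply, hfix (z, t) (Or.inr hz)]
    exact hψA _ hz

theorem HasHEP.of_homeomorph {L : Type*} [TopologicalSpace L] {A : Set K} {B : Set L}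
    (h : HasHEP A) (e : L ≃ₜ K) (he : ∀ x, x ∈ B ↔ e x ∈ A) : HasHEP B := by
  obtain ⟨r, hr, hfix⟩ := h
  refine ⟨⟨fun p => (e.symm (r (e p.1, p.2)).1, (r (e p.1, p.2)).2), by fun_prop⟩,
    fun p => ?_, fun p hp => ?_⟩
  · simpa [he] using hr (e p.1, p.2)
  · simp [hfix (e p.1, p.2) (hp.imp id (he _).1)]

/-- The boundary of a cylinder over a pair. -/
def cylinderBoundary (A : Set K) : Set (K × I) := {p | p.1 ∈ A ∨ p.2 = 0 ∨ p.2 = 1}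

theorem isClosed_cylinderBoundary {A : Set K} (hA : IsClosed A) :
    IsClosed (cylinderBoundary A) :=
  (hA.preimage continuous_fst).union
    ((isClosed_eq continuous_snd continuous_const).union
      (isClosed_eq continuous_snd continuous_const))

theorem isClosed_cubeBoundary (n : ℕ) : IsClosed (Cube.boundary (Fin n)) := by
  have : Cube.boundary (Fin n) = ⋃ i, ({y | y i = 0} ∪ {y | y i = 1}) := by
    ext y
    simp [Cube.boundary]
  rw [this]
  exact isClosed_iUnion_of_finite fun i =>
    (isClosed_eq (continuous_apply i) continuous_const).union
      (isClosed_eq (continuous_apply i) continuous_const)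

/-- Radial projection from a point above the centre of the top face. -/
theorem hasHEP_cubeBoundary (n : ℕ) : HasHEP (Cube.boundary (Fin n)) := by
  let ρ : (Fin n → I) → ℝ := fun z => ‖fun i => 2 * (z i : ℝ) - 1‖
  have hρ : Continuous ρ := by fun_prop
  let M : (Fin n → I) × I → ℝ := fun p => max (ρ p.1) (1 - (p.2 : ℝ) / 2)
  have hM : Continuous M := by fun_prop
  have hM0 : ∀ p, 0 < M p := fun p =>
    lt_of_lt_of_le (by linarith [p.2.2.2]) (le_max_right _ _)
  have hρ1 : ∀ z, ρ z ≤ 1 := fun z => by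
    refine (pi_norm_le_iff_of_nonneg zero_le_one).2 fun i => ?_
    rw [Real.norm_eq_abs, abs_le]
    constructor <;> linarith [(z i).2.1, (z i).2.2]
  have hatt : ∀ z, 0 < ρ z → ∃ i, |2 * (z i : ℝ) - 1| = ρ z := by
    intro z hz
    by_contra! hne
    refine lt_irrefl (ρ z) ((pi_norm_lt_iff hz).2 fun i => lt_of_le_of_ne ?_ (hne i))
    exact norm_le_pi_norm (fun i => 2 * (z i : ℝ) - 1) i
  refine ⟨⟨fun p => (fun i => projIcc 0 1 zero_le_one (1 / 2 + ((p.1 i : ℝ) - 1 / 2) / M p),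
    projIcc 0 1 zero_le_one (2 - (2 - (p.2 : ℝ)) / M p)), ?_⟩, fun p => ?_, fun p hp => ?_⟩
  · have hne : ∀ p, M p ≠ 0 := fun p => (hM0 p).ne'
    refine Continuous.prodMk (continuous_pi fun i => continuous_projIcc.comp ?_)
      (continuous_projIcc.comp ?_)
    · exact continuous_const.add (Continuous.div (by fun_prop) hM hne)
    · exact continuous_const.sub (Continuous.div (by fun_prop) hM hne)
  · rcases max_choice (ρ p.1) (1 - (p.2 : ℝ) / 2) with h | h
    · right
      have hMp : M p = ρ p.1 := h
      obtain ⟨i, hi⟩ := hatt p.1 (hMp ▸ hM0 p)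
      refine ⟨i, ?_⟩
      have hpos := hM0 p
      simp only [coe_mk]
      rcases abs_choice (2 * (p.1 i : ℝ) - 1) with h' | h' <;> rw [h', ← hMp] at hi
      · right
        have : (1 / 2 + ((p.1 i : ℝ) - 1 / 2) / M p) = 1 := by
          field_simp
          linarith
        rw [this, projIcc_right]; rfl
      · left
        have : (1 / 2 + ((p.1 i : ℝ) - 1 / 2) / M p) = 0 := by
          field_simp
          linarith
        rw [this, projIcc_left]; rfl
    · left
      have hMp : M p = 1 - (p.2 : ℝ) / 2 := h
      have hpos := hM0 p
      have : 2 - (2 - (p.2 : ℝ)) / M p = 0 := by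
        rw [sub_eq_zero, eq_div_iff hpos.ne', hMp]
        ring
      simp only [coe_mk]
      rw [this, projIcc_left]; rfl
  · have hMp : M p = 1 := by
      apply le_antisymm
      · exact max_le (hρ1 _) (by linarith [p.2.2.1])
      · rcases hp with hp | ⟨i, hi⟩
        · refine le_trans ?_ (le_max_right _ _)
          simp [hp]
        · refine le_trans ?_ (le_max_left _ _)
          refine le_trans ?_ (norm_le_pi_norm (fun i => 2 * (p.1 i : ℝ) - 1) i)
          rcases hi with hi | hi <;> norm_num [hi]
    refine Prod.ext (funext fun i => ?_) ?_
    · simp only [coe_mk, hMp]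
      ring_nf
      exact projIcc_val _ _
    · simp only [coe_mk, hMp]
      ring_nf
      exact projIcc_val _ _

/-- The homeomorphism splitting off the last coordinate of a cube. -/
def cubeSuccHomeomorph (n : ℕ) : (Fin n → I) × I ≃ₜ (Fin (n + 1) → I) where
  toFun p := Fin.snoc (α := fun _ => I) p.1 p.2
  invFun y := (Fin.init y, y (Fin.last n))
  left_inv p := by simp
  right_inv y := by simp
  continuous_toFun := Continuous.finSnoc (A := fun _ => I) continuous_fst continuous_snd
  continuous_invFun := by
    refine Continuous.prodMk (Continuous.finInit (A := fun _ => I) continuous_id)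
      (continuous_apply _)

theorem mem_cylinderBoundary_iff {n : ℕ} (p : (Fin n → I) × I) :
    p ∈ cylinderBoundary (Cube.boundary (Fin n)) ↔
      cubeSuccHomeomorph n p ∈ Cube.boundary (Fin (n + 1)) := by
  constructor
  · rintro (⟨i, hi⟩ | h)
    · exact ⟨i.castSucc, by simpa [cubeSuccHomeomorph] using hi⟩
    · exact ⟨Fin.last n, by simpa [cubeSuccHomeomorph] using h⟩
  · rintro ⟨i, hi⟩
    induction i using Fin.lastCases with
    | last => exact Or.inr (by simpa [cubeSuccHomeomorph] using hi)
    | cast i => exact Or.inl ⟨i, by simpa [cubeSuccHomeomorph] using hi⟩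

theorem hasHEP_cylinderBoundary (n : ℕ) : HasHEP (cylinderBoundary (Cube.boundary (Fin n))) :=
  (hasHEP_cubeBoundary (n + 1)).of_homeomorph (cubeSuccHomeomorph n) mem_cylinderBoundary_iff

end HomotopyExtension

section Compression

open Topology.Homotopy

variable {X Y : Type*} [TopologicalSpace X] [TopologicalSpace Y]

theorem genLoop_homotopic_iff {n : ℕ} {x : X} (p q : Ω^ (Fin n) X x) :
    GenLoop.Homotopic p q ↔ ∃ H : C((Fin n → I) × I, X), (∀ z, H (z, 0) = p z) ∧
      (∀ z, H (z, 1) = q z) ∧ ∀ z ∈ Cube.boundary (Fin n), ∀ t, H (z, t) = x := by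
  constructor
  · rintro ⟨F⟩
    refine ⟨⟨fun p => F (p.2, p.1), by fun_prop⟩, fun z => ?_, fun z => ?_, fun z hz t => ?_⟩
    · exact F.map_zero_left z
    · exact F.map_one_left z
    · exact (F.eq_fst t hz).trans (p.2 z hz)
  · rintro ⟨H, h0, h1, hA⟩
    refine ⟨⟨⟨⟨fun p => H (p.2, p.1), by fun_prop⟩, h0, h1⟩, fun t z hz => ?_⟩⟩
    exact (hA z hz t).trans (p.2 z hz).symm

theorem exists_extension_of_injective {n : ℕ} (f : C(X, Y))
    (hinj : ∀ x, Function.Injective (piMap n f (x := x) rfl))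
    (a : (Fin n → I) × I → X) (ha : ContinuousOn a (cylinderBoundary (Cube.boundary (Fin n))))
    (b : C((Fin n → I) × I, Y))
    (hb : ∀ p ∈ cylinderBoundary (Cube.boundary (Fin n)), b p = f (a p)) :
    ∃ a' : C((Fin n → I) × I, X),
      ∀ p ∈ cylinderBoundary (Cube.boundary (Fin n)), a' p = a p := by
  set A := Cube.boundary (Fin n)
  have hA : IsClosed A := isClosed_cubeBoundary n
  have hD : IsClosed (cylinderBoundary A) := isClosed_cylinderBoundary hA
  obtain ⟨r, hr, hfix⟩ := hasHEP_cubeBoundary n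
  have hrD : ∀ p, r p ∈ cylinderBoundary A := fun p =>
    (hr p).elim (fun h => Or.inr (Or.inl h)) Or.inl
  let p₀ : (Fin n → I) × I := (fun _ => 0, 0)
  -- contraction of the sides and the bottom inside themselves
  let c : C(((Fin n → I) × I) × I, (Fin n → I) × I) :=
    ⟨fun q => r (fun i => σ q.2 * q.1.1 i, σ q.2 * q.1.2), by fun_prop⟩
  have hc0 : ∀ p, p.2 = 0 ∨ p.1 ∈ A → c (p, 0) = p := fun p hp => by
    simpa [c] using hfix p hp
  have hc1 : ∀ p, c (p, 1) = p₀ := fun p => by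
    simpa [c] using hfix p₀ (Or.inl rfl)
  have hac : Continuous (a ∘ c) := ha.comp_continuous c.continuous fun q => hrD _
  obtain ⟨H, hH0, hHA⟩ := (hasHEP_cubeBoundary n).extend hA
    ⟨fun z => a (z, 1), ha.comp_continuous (by fun_prop) fun z => Or.inr (Or.inr rfl)⟩
    (fun q => a (c ((q.1, 1), q.2))) (by
      refine Continuous.continuousOn ?_
      exact hac.comp (by fun_prop : Continuous fun q : (Fin n → I) × I => ((q.1, (1 : I)), q.2)))
    (fun z hz => by simp [hc0 (z, 1) (Or.inr hz)])
  let Φ : ((Fin n → I) × I) × I → X := fun q => if q.1.2 = 1 then H (q.1.1, q.2) else a (c q)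
  have hΦtop : ∀ z s, Φ ((z, 1), s) = H (z, s) := fun z s => if_pos rfl
  have hΦJ : ∀ p s, p.2 = 0 ∨ p.1 ∈ A → Φ (p, s) = a (c (p, s)) := by
    rintro ⟨z, t⟩ s hp
    by_cases ht : t = 1
    · subst ht
      rcases hp with hp | hp
      · exact absurd hp one_ne_zero
      · rw [hΦtop, hHA z hp]
    · exact if_neg ht
  have hΦ : ContinuousOn Φ (cylinderBoundary A ×ˢ univ) := by
    have h1 : ContinuousOn Φ {q | q.1.2 = 1} :=
      (H.continuous.comp (by fun_prop : Continuous fun q : ((Fin n → I) × I) × I =>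
        (q.1.1, q.2))).continuousOn.congr fun q hq => if_pos hq
    have h2 : ContinuousOn Φ {q | q.1.2 = 0 ∨ q.1.1 ∈ A} :=
      hac.continuousOn.congr fun q hq => hΦJ q.1 q.2 hq
    refine (h1.union_of_isClosed h2 (isClosed_eq (by fun_prop) continuous_const)
      ((isClosed_eq (by fun_prop) continuous_const).union
        (hA.preimage (by fun_prop)))).mono ?_
    rintro q ⟨h | h | h, -⟩
    · exact Or.inr (Or.inr h)
    · exact Or.inr (Or.inl h)
    · exact Or.inl h
  have hΦ0 : ∀ p ∈ cylinderBoundary A, Φ (p, 0) = a p := by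
    rintro ⟨z, t⟩ (h | h | h)
    · rw [hΦJ _ _ (Or.inr h), hc0 _ (Or.inr h)]
    · rw [hΦJ _ _ (Or.inl h), hc0 _ (Or.inl h)]
    · obtain rfl : t = 1 := h
      rw [hΦtop, hH0]
      rfl
  have hΦ1 : ∀ p, p.2 = 0 ∨ p.1 ∈ A → Φ (p, 1) = a p₀ := fun p hp => by
    rw [hΦJ p 1 hp, hc1]
  obtain ⟨G, -, hGD⟩ := (hasHEP_cylinderBoundary n).extend hD b (f ∘ Φ)
    (f.continuous.comp_continuousOn hΦ) fun p hp => by simp [hΦ0 p hp, hb p hp]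
  let α : Ω^ (Fin n) X (a p₀) := ⟨⟨fun z => H (z, 1), by fun_prop⟩, fun z hz => by
    rw [← hΦ1 (z, 1) (Or.inr hz), hΦtop]
    rfl⟩
  have hnull : GenLoop.Homotopic (GenLoop.const : Ω^ (Fin n) X (a p₀)) α := by
    refine Quotient.exact (hinj (a p₀) (a₁ := ⟦GenLoop.const⟧) (a₂ := ⟦α⟧) (Quotient.sound ?_))
    refine (genLoop_homotopic_iff _ _).2 ⟨⟨fun p => G (p, 1), by fun_prop⟩, fun z => ?_,
      fun z => ?_, fun z hz t => ?_⟩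
    · refine (hGD (z, 0) (Or.inr (Or.inl rfl)) 1).trans ?_
      exact congrArg f (hΦ1 (z, 0) (Or.inl rfl))
    · refine (hGD (z, 1) (Or.inr (Or.inr rfl)) 1).trans ?_
      exact congrArg f (hΦtop z 1)
    · refine (hGD (z, t) (Or.inl hz) 1).trans ?_
      exact congrArg f (hΦ1 (z, t) (Or.inr hz))
  obtain ⟨k, hk0, hk1, hkA⟩ := (genLoop_homotopic_iff _ _).1 hnull
  obtain ⟨L, -, hLD⟩ := (hasHEP_cylinderBoundary n).extend hD k (fun q => Φ (q.1, σ q.2))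
    (hΦ.comp (by fun_prop) fun q hq => ⟨hq.1, mem_univ _⟩) (by
      rintro ⟨z, t⟩ h
      simp only [symm_zero]
      rcases h with h | h | h
      · rw [hΦ1 _ (Or.inr h)]
        exact (hkA z h t).symm
      · rw [hΦ1 _ (Or.inl h)]
        obtain rfl : t = 0 := h
        exact (hk0 z).symm
      · obtain rfl : t = 1 := h
        rw [hΦtop]
        exact (hk1 z).symm)
  refine ⟨⟨fun p => L (p, 1), by fun_prop⟩, fun p hp => ?_⟩
  refine (hLD p hp 1).trans ?_
  simp [hΦ0 p hp]

theorem exists_relative_homotopy_of_surjective {n : ℕ} (f : C(X, Y))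
    (hsurj : ∀ x, Function.Surjective (piMap n f (x := x) rfl))
    (a : C(Fin n → I, X)) (b : C(Fin n → I, Y)) (hb : ∀ z ∈ Cube.boundary (Fin n), b z = f (a z)) :
    ∃ (a' : C(Fin n → I, X)) (G : C((Fin n → I) × I, Y)),
      (∀ z ∈ Cube.boundary (Fin n), a' z = a z) ∧ (∀ z, G (z, 0) = b z) ∧
      (∀ z, G (z, 1) = f (a' z)) ∧ ∀ z ∈ Cube.boundary (Fin n), ∀ t, G (z, t) = b z := by
  set A := Cube.boundary (Fin n)
  have hA : IsClosed A := isClosed_cubeBoundary n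
  have hD : IsClosed (cylinderBoundary A) := isClosed_cylinderBoundary hA
  let x₀ := a fun _ => 0
  let c : C((Fin n → I) × I, X) := ⟨fun q => a fun i => q.2 * q.1 i, by fun_prop⟩
  have hc0 : ∀ z, c (z, 0) = x₀ := fun z => by simp [c, x₀]
  have hc1 : ∀ z, c (z, 1) = a z := fun z => by simp [c]
  obtain ⟨Hb, hHb0, hHbA⟩ := (hasHEP_cubeBoundary n).extend hA b (fun q => f (c (q.1, σ q.2)))
    (by fun_prop) fun z hz => by simp [hb z hz, hc1]
  let β : Ω^ (Fin n) Y (f x₀) := ⟨⟨fun z => Hb (z, 1), by fun_prop⟩, fun z hz => by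
    simp [hHbA z hz, hc0]⟩
  obtain ⟨ω', hω'⟩ := hsurj x₀ ⟦β⟧
  induction ω' using Quotient.inductionOn with | _ ω => ?_
  obtain ⟨k, hk0, hk1, hkA⟩ := (genLoop_homotopic_iff _ _).1 (Quotient.exact hω'.symm)
  have hk1' : ∀ z, k (z, 1) = f (ω z) := hk1
  have hk0' : ∀ z, k (z, 0) = Hb (z, 1) := hk0
  obtain ⟨Ha, hHa0, hHaA⟩ := (hasHEP_cubeBoundary n).extend hA ω.1 c
    (by fun_prop) fun z hz => (hc0 z).trans (ω.2 z hz).symm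
  have hHa0' : ∀ z, Ha (z, 0) = ω z := hHa0
  let φ : ((Fin n → I) × I) × I → Y := fun q =>
    if q.1.2 = 0 then Hb (q.1.1, σ q.2) else
      if q.1.2 = 1 then f (Ha (q.1.1, q.2)) else f (c (q.1.1, q.2))
  have hφ0 : ∀ z s, φ ((z, 0), s) = Hb (z, σ s) := fun z s => if_pos rfl
  have hφ1 : ∀ z s, φ ((z, 1), s) = f (Ha (z, s)) := fun z s => by simp [φ]
  have hφA : ∀ z ∈ A, ∀ t s, φ ((z, t), s) = f (c (z, s)) := by
    intro z hz t s
    by_cases h0 : t = 0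
    · subst h0
      rw [hφ0, hHbA z hz, symm_symm]
    · by_cases h1 : t = 1
      · subst h1
        rw [hφ1, hHaA z hz]
      · simp [φ, h0, h1]
  have hφ : ContinuousOn φ (cylinderBoundary A ×ˢ univ) := by
    have h1 : ContinuousOn φ {q | q.1.2 = 0} :=
      Continuous.continuousOn (f := fun q => Hb (q.1.1, σ q.2)) (by fun_prop) |>.congr (by
        rintro ⟨⟨z, t⟩, s⟩ (rfl : t = 0)
        exact hφ0 z s)
    have h2 : ContinuousOn φ {q | q.1.2 = 1} :=
      Continuous.continuousOn (f := fun q => f (Ha (q.1.1, q.2))) (by fun_prop) |>.congr (by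
        rintro ⟨⟨z, t⟩, s⟩ (rfl : t = 1)
        exact hφ1 z s)
    have h3 : ContinuousOn φ {q | q.1.1 ∈ A} :=
      Continuous.continuousOn (f := fun q => f (c (q.1.1, q.2))) (by fun_prop) |>.congr (by
        rintro ⟨⟨z, t⟩, s⟩ hz
        exact hφA z hz t s)
    have c1 : IsClosed {q : ((Fin n → I) × I) × I | q.1.2 = 0} :=
      isClosed_eq (by fun_prop) continuous_const
    have c2 : IsClosed {q : ((Fin n → I) × I) × I | q.1.2 = 1} :=
      isClosed_eq (by fun_prop) continuous_const
    refine (h3.union_of_isClosed (h1.union_of_isClosed h2 c1 c2) (hA.preimage (by fun_prop))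
      (c1.union c2)).mono ?_
    rintro q ⟨h, -⟩
    exact h
  obtain ⟨G, -, hG⟩ := (hasHEP_cylinderBoundary n).extend hD k φ hφ (by
    rintro ⟨z, t⟩ (h | h | h)
    · rw [hφA z h, hc0]
      exact (hkA z h t).symm
    · obtain rfl : t = 0 := h
      rw [hφ0, hk0', symm_zero]
    · obtain rfl : t = 1 := h
      rw [hφ1, hHa0', hk1'])
  refine ⟨⟨fun z => Ha (z, 1), by fun_prop⟩, ⟨fun p => G (p, 1), by fun_prop⟩, fun z hz => ?_,
    fun z => ?_, fun z => ?_, fun z hz t => ?_⟩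
  · exact (hHaA z hz 1).trans (hc1 z)
  · refine (hG (z, 0) (Or.inr (Or.inl rfl)) 1).trans ?_
    rw [hφ0, symm_one, hHb0]
  · exact (hG (z, 1) (Or.inr (Or.inr rfl)) 1).trans (hφ1 z 1)
  · refine (hG (z, t) (Or.inl hz) 1).trans ?_
    rw [hφA z hz, hc1, hb z hz]

/-- The path fibration of `f` restricted to maps over a cube has the strict extension property with
respect to the boundary. -/
theorem IsWeakHomotopyEquiv.exists_path_lift {f : C(X, Y)} (hf : IsWeakHomotopyEquiv f) {n : ℕ}
    (B : C(Fin n → I, Y)) (α : (Fin n → I) → X) (hα : ContinuousOn α (Cube.boundary (Fin n)))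
    (Γ : (Fin n → I) × I → Y) (hΓ : ContinuousOn Γ (Cube.boundary (Fin n) ×ˢ univ))
    (h0 : ∀ z ∈ Cube.boundary (Fin n), Γ (z, 0) = B z)
    (h1 : ∀ z ∈ Cube.boundary (Fin n), Γ (z, 1) = f (α z)) :
    ∃ (α' : C(Fin n → I, X)) (Γ' : C((Fin n → I) × I, Y)),
      (∀ z ∈ Cube.boundary (Fin n), α' z = α z) ∧
      (∀ z ∈ Cube.boundary (Fin n), ∀ t, Γ' (z, t) = Γ (z, t)) ∧
      (∀ z, Γ' (z, 0) = B z) ∧ ∀ z, Γ' (z, 1) = f (α' z) := by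
  set A := Cube.boundary (Fin n)
  have hA : IsClosed A := isClosed_cubeBoundary n
  have hD : IsClosed (cylinderBoundary A) := isClosed_cylinderBoundary hA
  obtain ⟨Bt, hBt0, hBtA⟩ := (hasHEP_cubeBoundary n).extend hA B Γ hΓ h0
  have hext : ∃ a : C(Fin n → I, X), ∀ z ∈ A, a z = α z := by
    cases n with
    | zero => exact ⟨const _ (α 0), fun z hz => hz.elim fun i _ => i.elim0⟩
    | succ n =>
      let e := cubeSuccHomeomorph n
      obtain ⟨a', ha'⟩ := exists_extension_of_injective f (fun x => (hf.2 n x).1) (α ∘ e)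
        (hα.comp e.continuous.continuousOn fun p hp => (mem_cylinderBoundary_iff p).1 hp)
        ⟨fun p => Bt (e p, 1), by fun_prop⟩ fun p hp => by
          have hp' := (mem_cylinderBoundary_iff p).1 hp
          simp only [coe_mk, Function.comp_apply]
          rw [hBtA _ hp', h1 _ hp']
      refine ⟨⟨fun z => a' (e.symm z), by fun_prop⟩, fun z hz => ?_⟩
      refine (ha' (e.symm z) ((mem_cylinderBoundary_iff _).2 ?_)).trans ?_
      · simpa [e] using hz
      · simp
  obtain ⟨a, ha⟩ := hext
  obtain ⟨α', G, hα', hG0, hG1, hGA⟩ := exists_relative_homotopy_of_surjective f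
    (fun x => (hf.2 n x).2) a ⟨fun z => Bt (z, 1), by fun_prop⟩ fun z hz => by
      simp [hBtA z hz, h1 z hz, ha z hz]
  simp only [coe_mk] at hG0 hGA
  let φ : ((Fin n → I) × I) × I → Y := fun q =>
    if q.1.2 = 0 then Bt (q.1.1, σ q.2) else
      if q.1.2 = 1 then f (α' q.1.1) else Γ (q.1.1, σ (q.2 * σ q.1.2))
  have hφ0 : ∀ z s, φ ((z, 0), s) = Bt (z, σ s) := fun z s => if_pos rfl
  have hφ1 : ∀ z s, φ ((z, 1), s) = f (α' z) := fun z s => by simp [φ]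
  have hφA : ∀ z ∈ A, ∀ t s, φ ((z, t), s) = Γ (z, σ (s * σ t)) := by
    intro z hz t s
    by_cases h0 : t = 0
    · subst h0
      rw [hφ0, hBtA z hz, symm_zero, mul_one]
    · by_cases ht : t = 1
      · subst ht
        rw [hφ1, symm_one, mul_zero, symm_zero, h1 z hz, hα' z hz, ha z hz]
      · simp [φ, h0, ht]
  have hφ : ContinuousOn φ (cylinderBoundary A ×ˢ univ) := by
    have h1 : ContinuousOn φ {q | q.1.2 = 0} :=
      Continuous.continuousOn (f := fun q => Bt (q.1.1, σ q.2)) (by fun_prop) |>.congr (by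
        rintro ⟨⟨z, t⟩, s⟩ (rfl : t = 0)
        exact hφ0 z s)
    have h2 : ContinuousOn φ {q | q.1.2 = 1} :=
      Continuous.continuousOn (f := fun q => f (α' q.1.1)) (by fun_prop) |>.congr (by
        rintro ⟨⟨z, t⟩, s⟩ (rfl : t = 1)
        exact hφ1 z s)
    have h3 : ContinuousOn φ {q | q.1.1 ∈ A} := by
      refine (hΓ.comp (f := fun q : ((Fin n → I) × I) × I => (q.1.1, σ (q.2 * σ q.1.2)))
        (by fun_prop) fun q hq => ⟨hq, mem_univ _⟩).congr ?_
      rintro ⟨⟨z, t⟩, s⟩ hz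
      exact hφA z hz t s
    have c1 : IsClosed {q : ((Fin n → I) × I) × I | q.1.2 = 0} :=
      isClosed_eq (by fun_prop) continuous_const
    have c2 : IsClosed {q : ((Fin n → I) × I) × I | q.1.2 = 1} :=
      isClosed_eq (by fun_prop) continuous_const
    refine (h3.union_of_isClosed (h1.union_of_isClosed h2 c1 c2) (hA.preimage (by fun_prop))
      (c1.union c2)).mono ?_
    rintro q ⟨h, -⟩
    exact h
  obtain ⟨W, -, hW⟩ := (hasHEP_cylinderBoundary n).extend hD G φ hφ (by
    rintro ⟨z, t⟩ (h | h | h)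
    · rw [hφA z h, zero_mul, symm_zero, hGA z h, hBtA z h]
    · obtain rfl : t = 0 := h
      rw [hφ0, hG0, symm_zero]
    · obtain rfl : t = 1 := h
      rw [hφ1, hG1])
  refine ⟨α', ⟨fun p => W (p, 1), by fun_prop⟩, fun z hz => ?_, fun z hz t => ?_, fun z => ?_,
    fun z => ?_⟩
  · rw [hα' z hz, ha z hz]
  · refine (hW (z, t) (Or.inl hz) 1).trans ?_
    rw [hφA z hz, one_mul, symm_symm]
  · refine (hW (z, 0) (Or.inr (Or.inl rfl)) 1).trans ?_
    rw [hφ0, symm_one, hBt0]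
  · exact (hW (z, 1) (Or.inr (Or.inr rfl)) 1).trans (hφ1 z 1)

end Compression

section LocalLifting

variable {X Y : Type*} [TopologicalSpace X] [TopologicalSpace Y]

/-- Strict lifting, relative to the boundary of a cube, for the path fibration of `f` restricted
to paths inside `V`. -/
def PathLiftsOver (f : C(X, Y)) (V : Set Y) : Prop :=
  ∀ (n : ℕ) (B : C(Fin n → I, Y)) (α : (Fin n → I) → X) (Γ : (Fin n → I) × I → Y),
    (∀ z, B z ∈ V) → ContinuousOn α (Cube.boundary (Fin n)) →
    ContinuousOn Γ (Cube.boundary (Fin n) ×ˢ univ) →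
    (∀ z ∈ Cube.boundary (Fin n), Γ (z, 0) = B z) →
    (∀ z ∈ Cube.boundary (Fin n), Γ (z, 1) = f (α z)) →
    (∀ z ∈ Cube.boundary (Fin n), ∀ t, Γ (z, t) ∈ V) →
    ∃ (α' : C(Fin n → I, X)) (Γ' : C((Fin n → I) × I, Y)),
      (∀ z ∈ Cube.boundary (Fin n), α' z = α z) ∧
      (∀ z ∈ Cube.boundary (Fin n), ∀ t, Γ' (z, t) = Γ (z, t)) ∧
      (∀ z, Γ' (z, 0) = B z) ∧ (∀ z, Γ' (z, 1) = f (α' z)) ∧ ∀ p, Γ' p ∈ V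

theorem IsWeakHomotopyEquiv.pathLiftsOver {f : C(X, Y)} {V : Set Y}
    (hf : IsWeakHomotopyEquiv (f.restrictPreimageCM V)) : PathLiftsOver f V := by
  classical
  intro n B α Γ hB hα hΓ h0 h1 hΓV
  let y₀ : V := ⟨B 0, hB 0⟩
  let x₀ : f ⁻¹' V := (hf.1 y₀).choose
  have hαV : ∀ z ∈ Cube.boundary (Fin n), f (α z) ∈ V := fun z hz => h1 z hz ▸ hΓV z hz 1
  let α₁ : (Fin n → I) → f ⁻¹' V := fun z => if h : f (α z) ∈ V then ⟨α z, h⟩ else x₀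
  let Γ₁ : (Fin n → I) × I → V := fun p => if h : Γ p ∈ V then ⟨Γ p, h⟩ else y₀
  have hα₁ : ∀ z ∈ Cube.boundary (Fin n), (α₁ z : X) = α z := fun z hz => by simp [α₁, hαV z hz]
  have hΓ₁ : ∀ z ∈ Cube.boundary (Fin n), ∀ t, (Γ₁ (z, t) : Y) = Γ (z, t) := fun z hz t => by
    simp [Γ₁, hΓV z hz t]
  obtain ⟨α', Γ', h2, h3, h4, h5⟩ := hf.exists_path_lift ⟨fun z => ⟨B z, hB z⟩, by fun_prop⟩ α₁
    (Topology.IsInducing.subtypeVal.continuousOn_iff.2 (hα.congr fun z hz => hα₁ z hz)) Γ₁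
    (Topology.IsInducing.subtypeVal.continuousOn_iff.2 (hΓ.congr fun p hp => hΓ₁ p.1 hp.1 p.2))
    (fun z hz => Subtype.ext ((hΓ₁ z hz 0).trans (h0 z hz)))
    (fun z hz => Subtype.ext ((hΓ₁ z hz 1).trans ((h1 z hz).trans (congrArg f (hα₁ z hz).symm))))
  refine ⟨⟨fun z => α' z, by fun_prop⟩, ⟨fun p => Γ' p, by fun_prop⟩, fun z hz => ?_,
    fun z hz t => ?_, fun z => ?_, fun z => ?_, fun p => (Γ' p).2⟩
  · exact (congrArg Subtype.val (h2 z hz)).trans (hα₁ z hz)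
  · exact (congrArg Subtype.val (h3 z hz t)).trans (hΓ₁ z hz t)
  · exact congrArg Subtype.val (h4 z)
  · exact congrArg Subtype.val (h5 z)

theorem PathLiftsOver.prodMap {X' Y' : Type*} [TopologicalSpace X'] [TopologicalSpace Y']
    {f : C(X, Y)} {f' : C(X', Y')} {V : Set Y} {W : Set Y'}
    (h : PathLiftsOver f V) (h' : PathLiftsOver f' W) :
    PathLiftsOver (f.prodMap f') (V ×ˢ W) := by
  intro n B α Γ hB hα hΓ h0 h1 hΓV
  obtain ⟨α₁, Γ₁, a1, a2, a3, a4, a5⟩ := h n ⟨fun z => (B z).1, by fun_prop⟩ (fun z => (α z).1)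
    (fun p => (Γ p).1) (fun z => (hB z).1) hα.fst hΓ.fst
    (fun z hz => congrArg Prod.fst (h0 z hz)) (fun z hz => congrArg Prod.fst (h1 z hz))
    fun z hz t => (hΓV z hz t).1
  obtain ⟨α₂, Γ₂, b1, b2, b3, b4, b5⟩ := h' n ⟨fun z => (B z).2, by fun_prop⟩ (fun z => (α z).2)
    (fun p => (Γ p).2) (fun z => (hB z).2) hα.snd hΓ.snd
    (fun z hz => congrArg Prod.snd (h0 z hz)) (fun z hz => congrArg Prod.snd (h1 z hz))
    fun z hz t => (hΓV z hz t).2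
  exact ⟨α₁.prodMk α₂, Γ₁.prodMk Γ₂, fun z hz => Prod.ext (a1 z hz) (b1 z hz),
    fun z hz t => Prod.ext (a2 z hz t) (b2 z hz t), fun z => Prod.ext (a3 z) (b3 z),
    fun z => Prod.ext (a4 z) (b4 z), fun p => ⟨a5 p, b5 p⟩⟩

/-- The boundary of a possibly degenerate subcube, relative to its affine span. -/
def cellBoundary {n : ℕ} (l u : Fin n → I) : Set (Fin n → I) :=
  {x | x ∈ Icc l u ∧ ∃ i, l i < u i ∧ (x i = l i ∨ x i = u i)}

theorem isClosed_cellBoundary {n : ℕ} (l u : Fin n → I) : IsClosed (cellBoundary l u) := by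
  have : cellBoundary l u = Icc l u ∩ ⋃ i, ⋃ _ : l i < u i, ({y | y i = l i} ∪ {y | y i = u i}) := by
    ext y
    simp [cellBoundary]
  rw [this]
  exact isClosed_Icc.inter <| isClosed_iUnion_of_finite fun i => isClosed_iUnion_of_finite fun _ =>
    (isClosed_eq (continuous_apply i) continuous_const).union
      (isClosed_eq (continuous_apply i) continuous_const)

theorem exists_cell_parametrization {n : ℕ} (l u : Fin n → I) (hlu : l ≤ u) :
    ∃ (d : ℕ) (w : C(Fin d → I, Fin n → I)) (m : C(Fin n → I, Fin d → I)),
      (∀ z, w z ∈ Icc l u) ∧ (∀ z ∈ Cube.boundary (Fin d), w z ∈ cellBoundary l u) ∧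
      (∀ x ∈ Icc l u, w (m x) = x) ∧ ∀ x ∈ cellBoundary l u, m x ∈ Cube.boundary (Fin d) := by
  let e := Fintype.equivFin {i // l i < u i}
  let w : (Fin (Fintype.card {i // l i < u i}) → I) → Fin n → I := fun z i =>
    if h : l i < u i then
      projIcc 0 1 zero_le_one ((l i : ℝ) + ((u i : ℝ) - l i) * (z (e ⟨i, h⟩) : ℝ)) else l i
  let m : (Fin n → I) → Fin (Fintype.card {i // l i < u i}) → I := fun x k =>
    projIcc 0 1 zero_le_one
      (((x (e.symm k) : ℝ) - l (e.symm k)) / ((u (e.symm k) : ℝ) - l (e.symm k)))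
  have hw : Continuous w := by
    refine continuous_pi fun i => ?_
    by_cases h : l i < u i
    · simp only [w, h, dif_pos]
      exact continuous_projIcc.comp (by fun_prop)
    · simp only [w, h]
      exact continuous_const
  have hm : Continuous m := continuous_pi fun k =>
    continuous_projIcc.comp (Continuous.div_const (by fun_prop) _)
  have hwval : ∀ z i, ∀ h : l i < u i,
      (w z i : ℝ) = (l i : ℝ) + ((u i : ℝ) - l i) * (z (e ⟨i, h⟩) : ℝ) := by
    intro z i h
    have h' : (l i : ℝ) < u i := h
    have hmem : (l i : ℝ) + ((u i : ℝ) - l i) * (z (e ⟨i, h⟩) : ℝ) ∈ Icc (0 : ℝ) 1 := by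
      have := (z (e ⟨i, h⟩)).2
      constructor
      · nlinarith [(l i).2.1, this.1]
      · nlinarith [(u i).2.2, this.2]
    simp only [w, h, dif_pos]
    rw [projIcc_of_mem _ hmem]
  have hwI : ∀ z, w z ∈ Icc l u := by
    intro z
    rw [← pi_univ_Icc]
    intro i _
    by_cases h : l i < u i
    · have h' : (l i : ℝ) < u i := h
      have h2 := (z (e ⟨i, h⟩)).2
      constructor
      · rw [← Subtype.coe_le_coe, hwval z i h]
        nlinarith [h2.1]
      · rw [← Subtype.coe_le_coe, hwval z i h]
        nlinarith [h2.2]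
    · simp only [w, h]
      exact ⟨le_rfl, hlu i⟩
  have hmval : ∀ x ∈ Icc l u, ∀ k, (m x k : ℝ) =
      ((x (e.symm k) : ℝ) - l (e.symm k)) / ((u (e.symm k) : ℝ) - l (e.symm k)) := by
    intro x hx k
    have h1 : (l (e.symm k) : ℝ) < u (e.symm k) := (e.symm k).2
    have h2 : (l (e.symm k) : ℝ) ≤ x (e.symm k) := hx.1 _
    have h3 : (x (e.symm k) : ℝ) ≤ u (e.symm k) := hx.2 _
    simp only [m]
    rw [projIcc_of_mem]
    exact ⟨div_nonneg (by linarith) (by linarith), (div_le_one (by linarith)).2 (by linarith)⟩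
  refine ⟨_, ⟨w, hw⟩, ⟨m, hm⟩, hwI, ?_, ?_, ?_⟩
  · rintro z ⟨k, hk⟩
    refine ⟨hwI z, e.symm k, (e.symm k).2, ?_⟩
    have h := hwval z (e.symm k) (e.symm k).2
    simp only [Subtype.coe_eta, Equiv.apply_symm_apply] at h
    rcases hk with hk | hk
    · left
      refine Subtype.ext (h.trans ?_)
      simp [hk]
    · right
      refine Subtype.ext (h.trans ?_)
      simp [hk]
  · intro x hx
    funext i
    by_cases h : l i < u i
    · refine Subtype.ext ((hwval _ i h).trans ?_)
      have h' : (l i : ℝ) < u i := h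
      have := hmval x hx (e ⟨i, h⟩)
      simp only [Equiv.symm_apply_apply] at this
      simp only [coe_mk]
      rw [this, mul_div_cancel₀ _ (by linarith)]
      ring
    · simp only [coe_mk, w, h]
      exact le_antisymm (hx.1 i) ((hx.2 i).trans (not_lt.1 h))
  · rintro x ⟨hx, i, hi, hxi⟩
    refine ⟨e ⟨i, hi⟩, ?_⟩
    have h := hmval x hx (e ⟨i, hi⟩)
    simp only [Equiv.symm_apply_apply] at h
    have h' : (l i : ℝ) < u i := hi
    rcases hxi with hxi | hxi
    · left
      refine Subtype.ext (h.trans ?_)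
      simp [hxi]
    · right
      refine Subtype.ext (h.trans ?_)
      rw [hxi, div_self (by linarith)]
      rfl

/-- Points of the path fibration of `f` over `y` whose path stays in `V`. -/
def pathFiber (f : C(X, Y)) (V : Set Y) (y : Y) : Set (X × C(I, Y)) :=
  {e | e.2 0 = y ∧ e.2 1 = f e.1 ∧ ∀ t, e.2 t ∈ V}

theorem PathLiftsOver.exists_cell_lift {f : C(X, Y)} {V : Set Y} (h : PathLiftsOver f V) {n : ℕ}
    (B : C(Fin n → I, Y)) (l u : Fin n → I) (hlu : l ≤ u) (hB : ∀ x ∈ Icc l u, B x ∈ V)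
    (g : (Fin n → I) → X × C(I, Y)) (hg : ContinuousOn g (cellBoundary l u))
    (hgV : ∀ x ∈ cellBoundary l u, g x ∈ pathFiber f V (B x)) :
    ∃ g' : (Fin n → I) → X × C(I, Y), ContinuousOn g' (Icc l u) ∧ EqOn g' g (cellBoundary l u) ∧
      ∀ x ∈ Icc l u, g' x ∈ pathFiber f V (B x) := by
  obtain ⟨d, w, m, hw, hwb, hwm, hmb⟩ := exists_cell_parametrization l u hlu
  have hgw : ContinuousOn (g ∘ w) (Cube.boundary (Fin d)) := hg.comp w.continuous.continuousOn hwb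
  obtain ⟨α', Γ', h1, h2, h3, h4, h5⟩ := h d (B.comp w) (fun z => (g (w z)).1)
    (fun p => (g (w p.1)).2 p.2) (fun z => hB _ (hw z)) hgw.fst
    (ContinuousOn.eval (hgw.snd.comp continuousOn_fst fun p hp => hp.1) continuousOn_snd)
    (fun z hz => (hgV _ (hwb z hz)).1) (fun z hz => (hgV _ (hwb z hz)).2.1)
    (fun z hz => (hgV _ (hwb z hz)).2.2)
  refine ⟨fun x => (α' (m x), Γ'.curry (m x)), Continuous.continuousOn (by fun_prop),
    fun x hx => ?_, fun x hx => ⟨?_, h4 _, fun t => h5 _⟩⟩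
  · refine Prod.ext ?_ (ContinuousMap.ext fun t => ?_)
    · simp only [h1 _ (hmb x hx), hwm x hx.1]
    · simp only [curry_apply, h2 _ (hmb x hx), hwm x hx.1]
  · simp only [curry_apply, h3, comp_apply, hwm x hx]

/-- If sections with prescribed boundary values exist over all cells meeting no cut, then they exist
over all cells. -/
theorem exists_section_of_cuts {n : ℕ} {E : Type*} [TopologicalSpace E] (T : Finset I)
    (adm : (Fin n → I) → Set E)
    (hcell : ∀ l u : Fin n → I, l ≤ u → (∀ i, ∀ t ∈ T, ¬ (l i < t ∧ t < u i)) →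
      ∀ g : (Fin n → I) → E, ContinuousOn g (cellBoundary l u) →
        (∀ x ∈ cellBoundary l u, g x ∈ adm x) →
        ∃ g' : (Fin n → I) → E, ContinuousOn g' (Icc l u) ∧ EqOn g' g (cellBoundary l u) ∧
          ∀ x ∈ Icc l u, g' x ∈ adm x)
    (l u : Fin n → I) (hlu : l ≤ u) (g : (Fin n → I) → E) (hg : ContinuousOn g (cellBoundary l u))
    (hgadm : ∀ x ∈ cellBoundary l u, g x ∈ adm x) :
    ∃ g' : (Fin n → I) → E, ContinuousOn g' (Icc l u) ∧ EqOn g' g (cellBoundary l u) ∧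
      ∀ x ∈ Icc l u, g' x ∈ adm x := by
  classical
  let cuts : (Fin n → I) → (Fin n → I) → ℕ := fun l u =>
    ∑ i, (T.filter fun t => l i < t ∧ t < u i).card
  have hcuts : ∀ l u l' u' : Fin n → I, ∀ i t, l ≤ l' → u' ≤ u → t ∈ T → l i < t → t < u i →
      (t ≤ l' i ∨ u' i ≤ t) → cuts l' u' < cuts l u := by
    intro l u l' u' i t hl hu ht h1 h2 h3
    refine Finset.sum_lt_sum (fun j _ => Finset.card_le_card ?_) ⟨i, Finset.mem_univ i,
      Finset.card_lt_card ⟨?_, fun hsub => ?_⟩⟩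
    · exact Finset.monotone_filter_right _ fun s _ hs =>
        ⟨(hl j).trans_lt hs.1, hs.2.trans_le (hu j)⟩
    · exact Finset.monotone_filter_right _ fun s _ hs =>
        ⟨(hl i).trans_lt hs.1, hs.2.trans_le (hu i)⟩
    · have := (Finset.mem_filter.1 (hsub (Finset.mem_filter.2 ⟨ht, h1, h2⟩))).2
      rcases h3 with h3 | h3
      · exact absurd this.1 (not_lt.2 h3)
      · exact absurd this.2 (not_lt.2 h3)
  induction hN : cuts l u using Nat.strong_induction_on generalizing l u g with | _ N ih => ?_
  by_cases hno : ∀ i, ∀ t ∈ T, ¬ (l i < t ∧ t < u i)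
  · exact hcell l u hlu hno g hg hgadm
  push Not at hno
  obtain ⟨i, t, htT, hlt, htu⟩ := hno
  subst hN
  let l' := Function.update l i t
  let u' := Function.update u i t
  have hll' : l ≤ l' := le_update_iff.2 ⟨hlt.le, fun _ _ => le_rfl⟩
  have hu'u : u' ≤ u := update_le_iff.2 ⟨htu.le, fun _ _ => le_rfl⟩
  have hl'i : l' i = t := by simp [l']
  have hu'i : u' i = t := by simp [u']
  have hl'j : ∀ j, j ≠ i → l' j = l j := fun j hj => by simp [l', hj]
  have hu'j : ∀ j, j ≠ i → u' j = u j := fun j hj => by simp [u', hj]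
  have hlu' : l ≤ u' := le_update_iff.2 ⟨hlt.le, fun j _ => hlu j⟩
  have hl'u : l' ≤ u := update_le_iff.2 ⟨htu.le, fun j _ => hlu j⟩
  have hl'u' : l' ≤ u' := fun j => by
    by_cases hj : j = i
    · subst hj
      rw [hl'i, hu'i]
    · rw [hl'j j hj, hu'j j hj]
      exact hlu j
  have hmidI : ∀ x, x ∈ Icc l' u' ↔ x ∈ Icc l u ∧ x i = t := by
    intro x
    constructor
    · intro hx
      exact ⟨⟨hll'.trans hx.1, hx.2.trans hu'u⟩,
        le_antisymm (hu'i ▸ hx.2 i) (hl'i ▸ hx.1 i)⟩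
    · rintro ⟨hx, rfl⟩
      exact ⟨update_le_iff.2 ⟨le_rfl, fun j _ => hx.1 j⟩,
        le_update_iff.2 ⟨le_rfl, fun j _ => hx.2 j⟩⟩
  have hleftI : ∀ x, x ∈ Icc l u' ↔ x ∈ Icc l u ∧ x i ≤ t := by
    intro x
    constructor
    · intro hx
      exact ⟨⟨hx.1, hx.2.trans hu'u⟩, hu'i ▸ hx.2 i⟩
    · rintro ⟨hx, hxt⟩
      exact ⟨hx.1, le_update_iff.2 ⟨hxt, fun j _ => hx.2 j⟩⟩
  have hrightI : ∀ x, x ∈ Icc l' u ↔ x ∈ Icc l u ∧ t ≤ x i := by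
    intro x
    constructor
    · intro hx
      exact ⟨⟨hll'.trans hx.1, hx.2⟩, hl'i ▸ hx.1 i⟩
    · rintro ⟨hx, hxt⟩
      exact ⟨update_le_iff.2 ⟨hxt, fun j _ => hx.1 j⟩, hx.2⟩
  have hmidB : ∀ x ∈ Icc l' u', x ∈ cellBoundary l u → x ∈ cellBoundary l' u' := by
    rintro x hx ⟨_, j, hj, hxj⟩
    by_cases hji : j = i
    · subst hji
      rw [((hmidI x).1 hx).2] at hxj
      rcases hxj with h | h
      · exact absurd h hlt.ne'
      · exact absurd h htu.ne
    · exact ⟨hx, j, by rwa [hl'j j hji, hu'j j hji], by rwa [hl'j j hji, hu'j j hji]⟩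
  have hmidB' : cellBoundary l' u' ⊆ cellBoundary l u := by
    rintro x ⟨hx, j, hj, hxj⟩
    have hji : j ≠ i := by
      rintro rfl
      rw [hl'i, hu'i] at hj
      exact lt_irrefl _ hj
    rw [hl'j j hji, hu'j j hji] at hj hxj
    exact ⟨((hmidI x).1 hx).1, j, hj, hxj⟩
  obtain ⟨gm, hgm, hgmB, hgmadm⟩ := ih _ (hcuts l u l' u' i t hll' hu'u htT hlt htu
    (Or.inl hl'i.ge)) l' u' hl'u' g (hg.mono hmidB') (fun x hx => hgadm x (hmidB' hx)) rfl
  let g₁ : (Fin n → I) → E := fun x => if x ∈ Icc l' u' then gm x else g x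
  have hg₁m : ∀ x ∈ Icc l' u', g₁ x = gm x := fun x hx => if_pos hx
  have hg₁B : ∀ x ∈ cellBoundary l u, g₁ x = g x := by
    intro x hx
    by_cases h : x ∈ Icc l' u'
    · rw [hg₁m x h]
      exact hgmB (hmidB x h hx)
    · exact if_neg h
  have hg₁ : ContinuousOn g₁ (cellBoundary l u ∪ Icc l' u') :=
    (hg.congr hg₁B).union_of_isClosed (hgm.congr hg₁m) (isClosed_cellBoundary l u) isClosed_Icc
  have hg₁adm : ∀ x ∈ cellBoundary l u ∪ Icc l' u', g₁ x ∈ adm x := by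
    rintro x (hx | hx)
    · exact hg₁B x hx ▸ hgadm x hx
    · exact hg₁m x hx ▸ hgmadm x hx
  have hleftB : cellBoundary l u' ⊆ cellBoundary l u ∪ Icc l' u' := by
    rintro x ⟨hx, j, hj, hxj⟩
    have hx' := ((hleftI x).1 hx).1
    by_cases hji : j = i
    · subst hji
      rw [hu'i] at hxj
      rcases hxj with h | h
      · exact Or.inl ⟨hx', j, hlt.trans htu, Or.inl h⟩
      · exact Or.inr ((hmidI x).2 ⟨hx', h⟩)
    · rw [hu'j j hji] at hj hxj
      exact Or.inl ⟨hx', j, hj, hxj⟩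
  have hrightB : cellBoundary l' u ⊆ cellBoundary l u ∪ Icc l' u' := by
    rintro x ⟨hx, j, hj, hxj⟩
    have hx' := ((hrightI x).1 hx).1
    by_cases hji : j = i
    · subst hji
      rw [hl'i] at hxj
      rcases hxj with h | h
      · exact Or.inr ((hmidI x).2 ⟨hx', h⟩)
      · exact Or.inl ⟨hx', j, hlt.trans htu, Or.inr h⟩
    · rw [hl'j j hji] at hj hxj
      exact Or.inl ⟨hx', j, hj, hxj⟩
  obtain ⟨gl, hgl, hglB, hgladm⟩ := ih _ (hcuts l u l u' i t le_rfl hu'u htT hlt htu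
    (Or.inr hu'i.le)) l u' hlu' g₁ (hg₁.mono hleftB) (fun x hx => hg₁adm x (hleftB hx)) rfl
  obtain ⟨gr, hgr, hgrB, hgradm⟩ := ih _ (hcuts l u l' u i t hll' le_rfl htT hlt htu
    (Or.inl hl'i.ge)) l' u hl'u g₁ (hg₁.mono hrightB) (fun x hx => hg₁adm x (hrightB hx)) rfl
  let G : (Fin n → I) → E := fun x => if x i ≤ t then gl x else gr x
  have hGl : ∀ x ∈ Icc l u', G x = gl x := fun x hx => if_pos ((hleftI x).1 hx).2
  have hGr : ∀ x ∈ Icc l' u, G x = gr x := by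
    intro x hx
    by_cases h : x i ≤ t
    · have hx' := (hrightI x).1 hx
      have hxt : x i = t := le_antisymm h hx'.2
      have h1 : x ∈ cellBoundary l u' :=
        ⟨(hleftI x).2 ⟨hx'.1, h⟩, i, hu'i.symm ▸ hlt, Or.inr (hxt.trans hu'i.symm)⟩
      have h2 : x ∈ cellBoundary l' u := ⟨hx, i, hl'i.symm ▸ htu, Or.inl (hxt.trans hl'i.symm)⟩
      exact (if_pos h).trans ((hglB h1).trans (hgrB h2).symm)
    · exact if_neg h
  have hcover : ∀ x ∈ Icc l u, x ∈ Icc l u' ∪ Icc l' u := fun x hx =>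
    (le_total (x i) t).imp (fun h => (hleftI x).2 ⟨hx, h⟩) fun h => (hrightI x).2 ⟨hx, h⟩
  refine ⟨G, (((hgl.congr hGl).union_of_isClosed (hgr.congr hGr) isClosed_Icc isClosed_Icc).mono
    hcover), ?_, fun x hx => ?_⟩
  · rintro x hx
    obtain ⟨hxI, j, hj, hxj⟩ := hx
    have hx : x ∈ cellBoundary l u := ⟨hxI, j, hj, hxj⟩
    rcases hcover x hxI with h | h
    · refine (hGl x h).trans ((hglB ⟨h, ?_⟩).trans (hg₁B x hx))
      by_cases hji : j = i
      · subst hji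
        refine ⟨j, hu'i.symm ▸ hlt, Or.inl (hxj.resolve_right fun h' => ?_)⟩
        exact absurd ((hleftI x).1 h).2 (not_le.2 (h' ▸ htu))
      · exact ⟨j, by rwa [hu'j j hji], by rwa [hu'j j hji]⟩
    · refine (hGr x h).trans ((hgrB ⟨h, ?_⟩).trans (hg₁B x hx))
      by_cases hji : j = i
      · subst hji
        refine ⟨j, hl'i.symm ▸ htu, Or.inr (hxj.resolve_left fun h' => ?_)⟩
        exact absurd ((hrightI x).1 h).2 (not_le.2 (h' ▸ hlt))
      · exact ⟨j, by rwa [hl'j j hji], by rwa [hl'j j hji]⟩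
  · rcases hcover x hx with h | h
    · exact hGl x h ▸ hgladm x h
    · exact hGr x h ▸ hgradm x h

end LocalLifting

section Globalization

variable {X Y : Type*} [TopologicalSpace X] [TopologicalSpace Y]

theorem exists_Icc_mem_nhds_subset_pi {n : ℕ} {x : Fin n → I} {s : Set (Fin n → I)}
    (hs : s ∈ 𝓝 x) : ∃ lo hi : Fin n → I, Icc lo hi ∈ 𝓝 x ∧ Icc lo hi ⊆ s := by
  rw [nhds_pi, Filter.mem_pi'] at hs
  obtain ⟨J, t, ht, hts⟩ := hs
  choose lo hi _ hmem hsub using fun i => exists_Icc_mem_subset_of_mem_nhds (ht i)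
  refine ⟨lo, hi, ?_, fun y hy => hts fun i _ => hsub i ⟨hy.1 i, hy.2 i⟩⟩
  rw [← pi_univ_Icc]
  exact set_pi_mem_nhds finite_univ fun i _ => hmem i

theorem cellBoundary_zero_one (n : ℕ) :
    cellBoundary (fun _ : Fin n => (0 : I)) (fun _ => 1) = Cube.boundary (Fin n) := by
  ext x
  constructor
  · rintro ⟨-, i, -, hi⟩
    exact ⟨i, hi⟩
  · rintro ⟨i, hi⟩
    exact ⟨⟨fun _ => nonneg', fun _ => le_one'⟩, i, zero_lt_one, hi⟩

/-- Local path lifting over a basis closed under finite intersections gives relative lifting up to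
homotopy over an open set. -/
theorem exists_lift_of_local (f : C(X, Y)) {𝒱 : Set (Set Y)} (h𝒱 : FiniteInter 𝒱)
    (hlift : ∀ V ∈ 𝒱, PathLiftsOver f V) {U : Set Y}
    (hU : ∀ y ∈ U, ∃ V ∈ 𝒱, IsOpen V ∧ y ∈ V ∧ V ⊆ U) {n : ℕ}
    (B : C(Fin n → I, Y)) (hB : ∀ z, B z ∈ U) (α : (Fin n → I) → X)
    (hα : ContinuousOn α (Cube.boundary (Fin n)))
    (hBα : ∀ z ∈ Cube.boundary (Fin n), B z = f (α z)) :
    ∃ (α' : C(Fin n → I, X)) (Γ : C((Fin n → I) × I, Y)),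
      (∀ z ∈ Cube.boundary (Fin n), α' z = α z) ∧
      (∀ z ∈ Cube.boundary (Fin n), ∀ t, Γ (z, t) = B z) ∧
      (∀ z, Γ (z, 0) = B z) ∧ (∀ z, Γ (z, 1) = f (α' z)) ∧ ∀ p, Γ p ∈ U := by
  classical
  choose V hV𝒱 hVo hVB hVU using fun z => hU (B z) (hB z)
  choose lo hi hnhds hsub using fun z => exists_Icc_mem_nhds_subset_pi
    (B.continuous.continuousAt.preimage_mem_nhds ((hVo z).mem_nhds (hVB z)))
  obtain ⟨J, hJ⟩ := CompactSpace.elim_nhds_subcover (fun z => Icc (lo z) (hi z)) hnhds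
  let T : Finset I := J.biUnion fun j => Finset.univ.image (lo j) ∪ Finset.univ.image (hi j)
  have hTlo : ∀ j ∈ J, ∀ i, lo j i ∈ T := fun j hj i => Finset.mem_biUnion.2
    ⟨j, hj, Finset.mem_union_left _ (Finset.mem_image_of_mem _ (Finset.mem_univ i))⟩
  have hThi : ∀ j ∈ J, ∀ i, hi j i ∈ T := fun j hj i => Finset.mem_biUnion.2
    ⟨j, hj, Finset.mem_union_right _ (Finset.mem_image_of_mem _ (Finset.mem_univ i))⟩
  let adm : (Fin n → I) → Set (X × C(I, Y)) := fun x =>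
    {e | e ∈ pathFiber f univ (B x) ∧ ∀ j ∈ J, x ∈ Icc (lo j) (hi j) → ∀ t, e.2 t ∈ V j}
  have hcell : ∀ l u : Fin n → I, l ≤ u → (∀ i, ∀ t ∈ T, ¬ (l i < t ∧ t < u i)) →
      ∀ g : (Fin n → I) → X × C(I, Y), ContinuousOn g (cellBoundary l u) →
        (∀ x ∈ cellBoundary l u, g x ∈ adm x) →
        ∃ g' : (Fin n → I) → X × C(I, Y), ContinuousOn g' (Icc l u) ∧
          EqOn g' g (cellBoundary l u) ∧ ∀ x ∈ Icc l u, g' x ∈ adm x := by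
    intro l u hlu hcut g hg hgadm
    let S : Finset (Fin n → I) := J.filter fun j => Icc l u ⊆ Icc (lo j) (hi j)
    let W : Set Y := ⋂₀ ↑(S.image V)
    have hW : W ∈ 𝒱 := h𝒱.finiteInter_mem (S.image V) fun A hA => by
      obtain ⟨j, -, rfl⟩ := Finset.mem_image.1 (Finset.mem_coe.1 hA)
      exact hV𝒱 j
    have hmemW : ∀ y, y ∈ W ↔ ∀ j ∈ S, y ∈ V j := fun y => by
      simp [W]
    obtain ⟨g', hg', hgg', hg'W⟩ := (hlift W hW).exists_cell_lift B l u hlu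
      (fun x hx => (hmemW _).2 fun j hj => hsub j ((Finset.mem_filter.1 hj).2 hx)) g hg
      fun x hx => ⟨(hgadm x hx).1.1, (hgadm x hx).1.2.1, fun t => (hmemW _).2 fun j hj =>
        (hgadm x hx).2 j (Finset.mem_filter.1 hj).1 ((Finset.mem_filter.1 hj).2 hx.1) t⟩
    refine ⟨g', hg', hgg', fun x hx => ?_⟩
    by_cases hxb : x ∈ cellBoundary l u
    · exact hgg' hxb ▸ hgadm x hxb
    refine ⟨⟨(hg'W x hx).1, (hg'W x hx).2.1, fun _ => mem_univ _⟩, fun j hj hxj t => ?_⟩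
    refine (hmemW _).1 ((hg'W x hx).2.2 t) j (Finset.mem_filter.2 ⟨hj, ?_⟩)
    have hstrict : ∀ i, l i < u i → l i < x i ∧ x i < u i := fun i hi' =>
      ⟨lt_of_le_of_ne (hx.1 i) fun h => hxb ⟨hx, i, hi', Or.inl h.symm⟩,
        lt_of_le_of_ne (hx.2 i) fun h => hxb ⟨hx, i, hi', Or.inr h⟩⟩
    refine Icc_subset_Icc (fun i => ?_) fun i => ?_
    · rcases (hlu i).lt_or_eq with h | h
      · by_contra! hlt
        exact hcut i _ (hTlo j hj i) ⟨hlt, (hxj.1 i).trans_lt (hstrict i h).2⟩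
      · exact (hxj.1 i).trans ((hx.2 i).trans h.ge)
    · rcases (hlu i).lt_or_eq with h | h
      · by_contra! hlt
        exact hcut i _ (hThi j hj i) ⟨(hstrict i h).1.trans_le (hxj.2 i), hlt⟩
      · exact (h.ge.trans (hx.1 i)).trans (hxj.2 i)
  obtain ⟨g, hg, hgB, hgadm⟩ := exists_section_of_cuts T adm hcell (fun _ => 0) (fun _ => 1)
    (fun _ => zero_le_one) (fun x => (α x, ContinuousMap.const I (B x)))
    (by
      rw [cellBoundary_zero_one]
      exact hα.prodMk (ContinuousMap.continuous_const'.comp B.continuous).continuousOn)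
    (by
      rw [cellBoundary_zero_one]
      exact fun x hx => ⟨⟨rfl, hBα x hx, fun _ => mem_univ _⟩, fun j _ hxj _ => hsub j hxj⟩)
  have hI : ∀ x : Fin n → I, x ∈ Icc (fun _ => (0 : I)) (fun _ => 1) := fun x =>
    ⟨fun _ => nonneg', fun _ => le_one'⟩
  have hgc : Continuous g := continuousOn_univ.1 (hg.mono fun x _ => hI x)
  rw [cellBoundary_zero_one] at hgB
  refine ⟨⟨fun z => (g z).1, by fun_prop⟩, ⟨fun p => (g p.1).2 p.2, by fun_prop⟩,
    fun z hz => congrArg Prod.fst (hgB hz), fun z hz t => ?_, fun z => (hgadm z (hI z)).1.1,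
    fun z => (hgadm z (hI z)).1.2.1, fun p => ?_⟩
  · simp [hgB hz]
  · have hp : p.1 ∈ ⋃ z ∈ J, Icc (lo z) (hi z) := hJ ▸ mem_univ _
    simp only [mem_iUnion] at hp
    obtain ⟨j, hj, hpj⟩ := hp
    exact hVU j ((hgadm p.1 (hI _)).2 j hj hpj p.2)

theorem isWeakHomotopyEquiv_of_lift [Nonempty X] (f : C(X, Y))
    (h : ∀ (n : ℕ) (B : C(Fin n → I, Y)) (α : (Fin n → I) → X),
      ContinuousOn α (Cube.boundary (Fin n)) → (∀ z ∈ Cube.boundary (Fin n), B z = f (α z)) →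
      ∃ (α' : C(Fin n → I, X)) (Γ : C((Fin n → I) × I, Y)),
        (∀ z ∈ Cube.boundary (Fin n), α' z = α z) ∧
        (∀ z ∈ Cube.boundary (Fin n), ∀ t, Γ (z, t) = B z) ∧
        (∀ z, Γ (z, 0) = B z) ∧ ∀ z, Γ (z, 1) = f (α' z)) :
    IsWeakHomotopyEquiv f := by
  refine ⟨fun y => ?_, fun n x => ⟨fun p' q' hpq => ?_, fun β' => ?_⟩⟩
  · have hempty : ∀ z : Fin 0 → I, z ∉ Cube.boundary (Fin 0) := fun z hz => hz.choose.elim0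
    obtain ⟨α, Γ, -, -, h0, h1⟩ := h 0 (const _ y) (fun _ => Classical.arbitrary X)
      continuousOn_const fun z hz => (hempty z hz).elim
    have hj : Joined y (f (α 0)) := ⟨⟨⟨fun t => Γ (0, t), by fun_prop⟩, h0 0, h1 0⟩⟩
    exact ⟨α 0, Joined.symm hj⟩
  · induction p' using Quotient.inductionOn with | _ p => ?_
    induction q' using Quotient.inductionOn with | _ q => ?_
    obtain ⟨k, hk0, hk1, hkA⟩ := (genLoop_homotopic_iff _ _).1 (Quotient.exact hpq)
    have hk0' : ∀ z, k (z, 0) = f (p z) := hk0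
    have hk1' : ∀ z, k (z, 1) = f (q z) := hk1
    let a : (Fin n → I) × I → X := fun r => if r.2 = 0 then p r.1 else if r.2 = 1 then q r.1 else x
    have ha0 : ∀ z, a (z, 0) = p z := fun z => if_pos rfl
    have ha1 : ∀ z, a (z, 1) = q z := fun z => by simp [a]
    have haA : ∀ z ∈ Cube.boundary (Fin n), ∀ t, a (z, t) = x := fun z hz t => by
      have hp : p z = x := p.2 z hz
      have hq : q z = x := q.2 z hz
      simp [a, hp, hq]
    have ha : ContinuousOn a (cylinderBoundary (Cube.boundary (Fin n))) := by
      have h1 : ContinuousOn a {r | r.2 = 0} :=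
        (p.1.continuous.comp continuous_fst).continuousOn.congr (by
          rintro ⟨z, t⟩ (rfl : t = 0)
          exact ha0 z)
      have h2 : ContinuousOn a {r | r.2 = 1} :=
        (q.1.continuous.comp continuous_fst).continuousOn.congr (by
          rintro ⟨z, t⟩ (rfl : t = 1)
          exact ha1 z)
      have h3 : ContinuousOn a {r | r.1 ∈ Cube.boundary (Fin n)} :=
        continuousOn_const.congr fun r hr => haA r.1 hr r.2
      have c1 : IsClosed {r : (Fin n → I) × I | r.2 = 0} :=
        isClosed_eq continuous_snd continuous_const
      have c2 : IsClosed {r : (Fin n → I) × I | r.2 = 1} :=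
        isClosed_eq continuous_snd continuous_const
      exact h3.union_of_isClosed (h1.union_of_isClosed h2 c1 c2)
        ((isClosed_cubeBoundary n).preimage continuous_fst) (c1.union c2)
    let e := cubeSuccHomeomorph n
    have he : ∀ z ∈ Cube.boundary (Fin (n + 1)),
        e.symm z ∈ cylinderBoundary (Cube.boundary (Fin n)) := fun z hz =>
      (mem_cylinderBoundary_iff _).2 (by simpa [e] using hz)
    obtain ⟨a', -, ha', -⟩ := h (n + 1) ⟨fun z => k (e.symm z), by fun_prop⟩ (a ∘ e.symm)
      (ha.comp e.symm.continuous.continuousOn he) fun z hz => by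
        have hz' := he z hz
        simp only [coe_mk, Function.comp_apply]
        generalize e.symm z = r at hz'
        obtain ⟨w, t⟩ := r
        rcases hz' with hw | ht | ht
        · rw [haA w hw]
          exact hkA w hw t
        · obtain rfl : t = 0 := ht
          rw [ha0, hk0']
        · obtain rfl : t = 1 := ht
          rw [ha1, hk1']
    have hD : ∀ r ∈ cylinderBoundary (Cube.boundary (Fin n)), a' (e r) = a r := fun r hr => by
      simpa using ha' (e r) ((mem_cylinderBoundary_iff r).1 hr)
    refine Quotient.sound ((genLoop_homotopic_iff _ _).2 ⟨⟨fun r => a' (e r), by fun_prop⟩,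
      fun z => ?_, fun z => ?_, fun z hz t => ?_⟩)
    · exact (hD _ (Or.inr (Or.inl rfl))).trans (ha0 z)
    · exact (hD _ (Or.inr (Or.inr rfl))).trans (ha1 z)
    · exact (hD _ (Or.inl hz)).trans (haA z hz t)
  · induction β' using Quotient.inductionOn with | _ β => ?_
    obtain ⟨α, Γ, hα, hΓA, h0, h1⟩ := h n β.1 (fun _ => x) continuousOn_const
      fun z hz => β.2 z hz
    refine ⟨⟦⟨α, hα⟩⟧, Quotient.sound ?_⟩
    refine ((genLoop_homotopic_iff _ _).2 ⟨Γ, h0, h1, fun z hz t => ?_⟩ :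
      GenLoop.Homotopic β _).symm
    exact (hΓA z hz t).trans (β.2 z hz)

theorem isWeakHomotopyEquiv_restrictPreimage_of_local (f : C(X, Y))
    (hf : Function.Surjective f) {𝒱 : Set (Set Y)} (h𝒱 : FiniteInter 𝒱)
    (hlift : ∀ V ∈ 𝒱, PathLiftsOver f V) {U : Set Y}
    (hU : ∀ y ∈ U, ∃ V ∈ 𝒱, IsOpen V ∧ y ∈ V ∧ V ⊆ U) :
    IsWeakHomotopyEquiv (f.restrictPreimageCM U) := by
  rcases isEmpty_or_nonempty U with hE | ⟨⟨y, hy⟩⟩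
  · exact ⟨fun y => hE.elim y, fun n x => hE.elim ⟨f x, x.2⟩⟩
  obtain ⟨x, rfl⟩ := hf y
  have : Nonempty (f ⁻¹' U) := ⟨⟨x, hy⟩⟩
  refine isWeakHomotopyEquiv_of_lift _ fun n B α hα hBα => ?_
  obtain ⟨α', Γ, h1, h2, h3, h4, h5⟩ := exists_lift_of_local f h𝒱 hlift hU
    ⟨fun z => (B z : Y), by fun_prop⟩ (fun z => (B z).2) (fun z => (α z : X))
    (continuous_subtype_val.comp_continuousOn hα) fun z hz => congrArg Subtype.val (hBα z hz)
  have hα' : ∀ z, f (α' z) ∈ U := fun z => by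
    rw [← h4 z]
    exact h5 (z, 1)
  exact ⟨⟨fun z => ⟨α' z, hα' z⟩, α'.continuous.subtype_mk _⟩, ⟨fun p => ⟨Γ p, h5 p⟩, by fun_prop⟩,
    fun z hz => Subtype.ext (h1 z hz), fun z hz t => Subtype.ext (h2 z hz t),
    fun z => Subtype.ext (h3 z), fun z => Subtype.ext (h4 z)⟩

theorem finiteInter_openRectangles (Y₁ Y₂ : Type*) [TopologicalSpace Y₁] [TopologicalSpace Y₂] :
    FiniteInter {R : Set (Y₁ × Y₂) | ∃ V W, IsOpen V ∧ IsOpen W ∧ R = V ×ˢ W} where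
  univ_mem := ⟨univ, univ, isOpen_univ, isOpen_univ, univ_prod_univ.symm⟩
  inter_mem := by
    rintro _ ⟨V, W, hV, hW, rfl⟩ _ ⟨V', W', hV', hW', rfl⟩
    exact ⟨V ∩ V', W ∩ W', hV.inter hV', hW.inter hW', prod_inter_prod⟩

end Globalization

theorem product_of_locally_weak_equivalences
    {X₁ Y₁ X₂ Y₂ : Type*} [TopologicalSpace X₁] [TopologicalSpace Y₁]
    [TopologicalSpace X₂] [TopologicalSpace Y₂]
    [SecondCountableTopology X₁] [SecondCountableTopology Y₁]
    [SecondCountableTopology X₂] [SecondCountableTopology Y₂]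
    (f₁ : C(X₁, Y₁)) (f₂ : C(X₂, Y₂))
    (hs₁ : Function.Surjective f₁) (hs₂ : Function.Surjective f₂)
    (h₁ : ∀ U : Set Y₁, IsOpen U → IsWeakHomotopyEquiv (f₁.restrictPreimageCM U))
    (h₂ : ∀ U : Set Y₂, IsOpen U → IsWeakHomotopyEquiv (f₂.restrictPreimageCM U)) :
    ∀ U : Set (Y₁ × Y₂), IsOpen U →
      IsWeakHomotopyEquiv ((f₁.prodMap f₂).restrictPreimageCM U) := by
  intro U hU
  refine isWeakHomotopyEquiv_restrictPreimage_of_local _ (hs₁.prodMap hs₂)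
    (finiteInter_openRectangles Y₁ Y₂) ?_ fun y hy => ?_
  · rintro _ ⟨V, W, hV, hW, rfl⟩
    exact (h₁ V hV).pathLiftsOver.prodMap (h₂ W hW).pathLiftsOver
  · obtain ⟨V, W, hV, hy₁, hW, hy₂, hVW⟩ := mem_nhds_prod_iff'.1 (hU.mem_nhds hy)
    exact ⟨V ×ˢ W, ⟨V, W, hV, hW, rfl⟩, hV.prod hW, ⟨hy₁, hy₂⟩, hVW⟩
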